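/- arXiv:1109.4660 — 2 statements merged into one kernel-verified Lean document; each statement's English description precedes it below -/
import Mathlib

section
/- Let n, m be natural numbers with n+m ≥ 1 and let a be a real number with a ≠ 0 and a ≠ 1. Then for every k with 0 ≤ k ≤ ⌊(n+m−1)/2⌋, β_k^{(n,m)}(a) = a^{k−m} (1−a)^{m+k+1} · ((1/2)_{n+m−k} (1/2)_k)/((1/2)_n (1/2)_m) · C(n−k−1, n+m−2k−1) · Σ_{j=0}^{n+m+1} ((−m−n−1)_j (m−k)_j)/((n+m−2k)_j · j!) · (1−a)^{−j} (the terminating series ₂F₁(−m−n−1, m−k; n+m−2k; 1/(1−a))), where a^{k−m} and (1−a)^{−j} are integer (possibly negative) powers of the nonzero reals a and 1−a, and C(n−k−1, n+m−2k−1) is the generalized binomial coefficient with (possibly negative) integer upper entry. -/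
open Finset

/-- The Bessel polynomial `q_n`, normalized so that `q_n(0) = 1`. -/
noncomputable def besselQ (n : ℕ) (u : ℝ) : ℝ :=
  ∑ k ∈ Finset.range (n + 1),
    ((n.factorial : ℝ) * (2 * n - k).factorial * 2 ^ k) /
      ((2 * n).factorial * (n - k).factorial * k.factorial) * u ^ k

/-- The Pochhammer symbol `(x)_j = x (x+1) ⋯ (x+j-1)`. -/
noncomputable def poch (x : ℝ) (j : ℕ) : ℝ := ∏ i ∈ Finset.range j, (x + i)

/-- Generalized binomial coefficient with integer (possibly negative) upper entry. -/
noncomputable def gbinom (z : ℤ) (j : ℕ) : ℝ :=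
  (∏ i ∈ Finset.range j, ((z : ℝ) - i)) / j.factorial


noncomputable section BesselAux
open PowerSeries

lemma gbinom_zero' (z : ℤ) : gbinom z 0 = 1 := by simp [gbinom]

lemma gbinom_succ_mul (z : ℤ) (j : ℕ) :
    gbinom z (j+1) * ((j:ℝ)+1) = gbinom z j * ((z:ℝ) - j) := by
  unfold gbinom
  rw [Finset.prod_range_succ, Nat.factorial_succ]
  have : (j.factorial : ℝ) ≠ 0 := by positivity
  have h2 : (j:ℝ)+1 ≠ 0 := by positivity
  push_cast
  field_simp

lemma gbinom_absorb (z : ℤ) (j : ℕ) :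
    gbinom (z+1) (j+1) * ((j:ℝ)+1) = ((z:ℝ)+1) * gbinom z j := by
  unfold gbinom
  rw [Finset.prod_range_succ', Nat.factorial_succ]
  have : (j.factorial : ℝ) ≠ 0 := by positivity
  have h2 : (j:ℝ)+1 ≠ 0 := by positivity
  push_cast
  have h3 : ∀ i : ℕ, (z:ℝ) + 1 - ((i:ℝ)+1) = z - i := fun i => by ring
  simp only [h3]
  field_simp
  ring

lemma gbinom_pascal (z : ℤ) (j : ℕ) :
    gbinom (z+1) (j+1) = gbinom z (j+1) + gbinom z j := by
  have h2 : (j:ℝ)+1 ≠ 0 := by positivity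
  apply mul_right_cancel₀ h2
  rw [gbinom_absorb]; linear_combination -(gbinom_succ_mul z j)

lemma gbinom_nat_zero (p j : ℕ) (h : p < j) : gbinom (p:ℤ) j = 0 := by
  unfold gbinom
  rw [Finset.prod_eq_zero (Finset.mem_range.2 h) (by simp)]; simp

/-- binomial series -/
def FS (z : ℤ) : PowerSeries ℝ := PowerSeries.mk (gbinom z)

def YS (s : ℝ) : PowerSeries ℝ := 1 + C s * X

lemma FS_succ (z : ℤ) : FS (z+1) = (1 + X) * FS z := by
  ext j
  rw [add_mul, one_mul, map_add]
  cases j with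
  | zero => simp [FS, gbinom_zero']
  | succ j => rw [PowerSeries.coeff_succ_X_mul]; simp [FS, gbinom_pascal]

lemma FS_deriv (z : ℤ) : derivative ℝ (FS (z+1)) = C ((z:ℝ)+1) * FS z := by
  ext j
  rw [PowerSeries.coeff_derivative, PowerSeries.coeff_C_mul]
  simp [FS, gbinom_absorb]

lemma YS_deriv (s : ℝ) (M : ℕ) :
    derivative ℝ (YS s ^ (M+1)) = C ((M:ℝ)+1) * C s * YS s ^ M := by
  rw [Derivation.leibniz_pow]
  have : derivative ℝ (YS s) = C s := by
    simp [YS, Derivation.leibniz]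
  rw [this]
  simp
  ring

def cc (s : ℝ) (p : ℤ) (M K : ℕ) : ℝ := coeff K (FS p * YS s ^ M)

lemma YS_coeff (s : ℝ) (M j : ℕ) : coeff j (YS s ^ M) = (M.choose j : ℝ) * s ^ j := by
  induction M generalizing j with
  | zero => cases j <;> simp [PowerSeries.coeff_one]
  | succ M ih =>
    have : YS s ^ (M+1) = YS s ^ M + C s * (X * YS s ^ M) := by
      rw [pow_succ]; nth_rewrite 2 [YS]; ring
    rw [this, map_add, PowerSeries.coeff_C_mul]
    cases j with
    | zero => simp [ih]
    | succ j =>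
      rw [PowerSeries.coeff_succ_X_mul, ih, ih, Nat.choose_succ_succ]
      push_cast; ring

lemma cc_sum (s : ℝ) (p : ℤ) (M K : ℕ) :
    cc s p M K = ∑ j ∈ range (K+1), (M.choose j : ℝ) * s ^ j * gbinom p (K - j) := by
  unfold cc
  rw [mul_comm, PowerSeries.coeff_mul, Finset.Nat.sum_antidiagonal_eq_sum_range_succ_mk]
  apply Finset.sum_congr rfl
  intro j _
  rw [YS_coeff]; simp [FS]

lemma cc_vanish (s : ℝ) (p M K : ℕ) (h : p + M < K) : cc s (p:ℤ) M K = 0 := by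
  rw [cc_sum]
  apply Finset.sum_eq_zero
  intro j _
  by_cases hj : M < j
  · simp [Nat.choose_eq_zero_of_lt hj]
  · rw [gbinom_nat_zero p _ (by omega)]; simp

lemma cc_top (s : ℝ) (p : ℤ) (M : ℕ) : cc s p M 0 = 1 := by
  rw [cc_sum]; simp [gbinom_zero']

lemma keyN (s : ℝ) (p : ℤ) (M L : ℕ) (n k : ℝ) (hk : k = M + 1 - L) (hn : n = p + 1 + k) :
    ((L:ℝ)+1/2) * cc s (p+1) (M+3) (2*L+2) = s*(n+1/2) * cc s p (M+2) (2*L)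
      + (L+1/2) * cc s (p+1) (M+1) (2*L+2) - s*(1-s)*(k+1/2) * cc s p (M+1) (2*L) := by
  unfold cc
  set H := FS (p+1) * YS s ^ (M+1) with hH
  set W := FS (p+1) * (YS s ^ (M+1) + YS s ^ (M+2)) with hW
  have e1 : FS (p+1) * YS s ^ (M+3) = H + C s * (X * W) := by
    rw [hH, hW]
    have : YS s ^ (M+3) = YS s ^ (M+1) * YS s * YS s := by ring
    rw [this, show YS s ^ (M+2) = YS s ^ (M+1) * YS s by ring]
    nth_rewrite 3 4 [YS]
    simp only [YS]; ring
  have dH : derivative ℝ H = FS (p+1) * (C ((M:ℝ)+1) * C s * YS s ^ M)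
      + YS s ^ (M+1) * (C ((p:ℝ)+1) * FS p) := by
    rw [hH, Derivation.leibniz, YS_deriv, FS_deriv]; simp
  have dW : derivative ℝ W = FS (p+1) * (C ((M:ℝ)+1) * C s * YS s ^ M
        + C ((M:ℝ)+1+1) * C s * YS s ^ (M+1))
      + (YS s ^ (M+1) + YS s ^ (M+2)) * (C ((p:ℝ)+1) * FS p) := by
    rw [hW, Derivation.leibniz, map_add, YS_deriv, YS_deriv, FS_deriv]; simp
  have key : derivative ℝ W = C (2*n+1) * (FS p * YS s ^ (M+2))
      - C ((1-s)*(2*k+1)) * (FS p * YS s ^ (M+1))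
      - C s * (X * derivative ℝ H - C (2*(L:ℝ)) * H) := by
    rw [dW, dH, hH, FS_succ]
    have hY : YS s ^ (M+2) = YS s ^ M * (1 + C s * X) * (1 + C s * X) := by
      simp only [YS]; ring
    have hY1 : YS s ^ (M+1) = YS s ^ M * (1 + C s * X) := by
      simp only [YS]; ring
    rw [hY, hY1]
    have hL : (L:ℝ) = M + 1 - k := by linarith
    rw [hL, hn]
    simp only [map_add, map_sub, map_mul, map_one, map_ofNat]
    ring
  have c1 : coeff (2*L) (derivative ℝ W) = coeff (2*L+1) W * (2*L+1) := by
    rw [PowerSeries.coeff_derivative]; push_cast; ring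
  have c2 : coeff (2*L) (X * derivative ℝ H) = 2*L * coeff (2*L) H := by
    cases hh : 2*L with
    | zero => have : L = 0 := by omega
              simp [this]
    | succ r =>
      rw [PowerSeries.coeff_succ_X_mul, PowerSeries.coeff_derivative]
      have : (2*(L:ℝ)) = r + 1 := by exact_mod_cast hh
      rw [this]; ring
  have := congrArg (coeff (2*L)) key
  rw [c1] at this
  simp only [map_sub, PowerSeries.coeff_C_mul, c2] at this
  rw [e1, map_add, PowerSeries.coeff_C_mul, PowerSeries.coeff_succ_X_mul]
  linear_combination (s/2) * this

lemma keyM (s : ℝ) (p : ℤ) (M L : ℕ) (n k m : ℝ) (hk : k = M + 1 - L)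
    (hn : n = p + 1 + k) (hm : m = M + 1 - n) :
    ((L:ℝ)+1/2) * cc s p (M+3) (2*L+2) = (1-s)*(m+1/2) * cc s p (M+2) (2*L)
      + (L+1/2) * cc s (p+2) (M+1) (2*L+2) - s*(1-s)*(k+1/2) * cc s (p+1) (M+1) (2*L) := by
  unfold cc
  obtain ⟨p, rfl⟩ : ∃ r, p = r + 1 := ⟨p-1, by ring⟩
  rw [show p + 1 + 2 = p + 1 + 1 + 1 by ring]
  set W := FS (p+1) * YS s ^ (M+2) + FS (p+1+1) * YS s ^ (M+1) with hW
  set H := FS (p+1) * YS s ^ (M+2) + C s * (FS (p+1+1) * YS s ^ (M+1)) with hH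
  have e1 : FS (p+1) * YS s ^ (M+3) = FS (p+1+1+1) * YS s ^ (M+1) - C (1-s) * (X * W) := by
    rw [hW, FS_succ (p+1+1), FS_succ (p+1)]
    have : YS s ^ (M+3) = YS s ^ (M+1) * (1 + C s * X) * (1 + C s * X) := by
      simp only [YS]; ring
    rw [this, show YS s ^ (M+2) = YS s ^ (M+1) * (1 + C s * X) by simp only [YS]; ring]
    simp only [map_sub, map_one]
    ring
  have d1 : derivative ℝ (FS (p+1) * YS s ^ (M+2)) =
      FS (p+1) * (C ((M:ℝ)+1+1) * C s * YS s ^ (M+1)) + YS s ^ (M+2) * (C ((p:ℝ)+1) * FS p) := by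
    rw [Derivation.leibniz, YS_deriv, FS_deriv]; simp
  have d2 : derivative ℝ (FS (p+1+1) * YS s ^ (M+1)) =
      FS (p+1+1) * (C ((M:ℝ)+1) * C s * YS s ^ M)
        + YS s ^ (M+1) * (C ((p:ℝ)+1+1) * FS (p+1)) := by
    rw [Derivation.leibniz, YS_deriv, FS_deriv]; simp
  have key : derivative ℝ W = C (s*(2*k+1)) * (FS (p+1+1) * YS s ^ (M+1))
      - C (2*m+1) * (FS (p+1) * YS s ^ (M+2))
      - (X * derivative ℝ H - C (2*(L:ℝ)) * H) := by
    rw [hW, hH, map_add (derivative ℝ), map_add (derivative ℝ), (derivative ℝ).leibniz (C s), d1, d2, FS_succ (p+1), FS_succ p]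
    have hY : YS s ^ (M+2) = YS s ^ M * (1 + C s * X) * (1 + C s * X) := by
      simp only [YS]; ring
    have hY1 : YS s ^ (M+1) = YS s ^ M * (1 + C s * X) := by
      simp only [YS]; ring
    rw [hY, hY1]
    have hL : (L:ℝ) = M + 1 - k := by linarith
    rw [hL, hm, hn]
    push_cast
    simp only [map_add, map_sub, map_mul, map_one, map_ofNat, smul_eq_mul, PowerSeries.derivative_C]
    ring
  have c1 : coeff (2*L) (derivative ℝ W) = coeff (2*L+1) W * (2*L+1) := by
    rw [PowerSeries.coeff_derivative]; push_cast; ring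
  have c2 : coeff (2*L) (X * derivative ℝ H) = 2*L * coeff (2*L) H := by
    cases hh : 2*L with
    | zero => have : L = 0 := by omega
              simp [this]
    | succ r =>
      rw [PowerSeries.coeff_succ_X_mul, PowerSeries.coeff_derivative]
      have : (2*(L:ℝ)) = r + 1 := by exact_mod_cast hh
      rw [this]; ring
  have := congrArg (coeff (2*L)) key
  rw [c1] at this
  simp only [map_sub, PowerSeries.coeff_C_mul, c2] at this
  rw [e1, map_sub, PowerSeries.coeff_C_mul, PowerSeries.coeff_succ_X_mul]
  linear_combination (-(1-s)/2) * this

end BesselAux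

noncomputable section BesselAux2

def qc (n k : ℕ) : ℝ := if k ≤ n then ((n.factorial : ℝ) * (2 * n - k).factorial * 2 ^ k) /
      ((2 * n).factorial * (n - k).factorial * k.factorial) else 0

lemma besselQ_eq (n N : ℕ) (h : n < N) (u : ℝ) :
    besselQ n u = ∑ k ∈ range N, qc n k * u ^ k := by
  unfold besselQ
  rw [← Finset.sum_subset (Finset.range_subset_range.2 (show n+1 ≤ N by omega))]
  · apply Finset.sum_congr rfl
    intro k hk
    rw [qc, if_pos (by have := Finset.mem_range.1 hk; omega)]
  · intro k _ hk
    rw [qc, if_neg (by intro h; exact hk (Finset.mem_range.2 (by omega)))]; simp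

lemma qc_zero (n : ℕ) : qc n 0 = 1 := by
  have h1 : ((2*n).factorial : ℝ) ≠ 0 := by positivity
  have h2 : (n.factorial : ℝ) ≠ 0 := by positivity
  simp [qc]; field_simp

lemma qc_one (n : ℕ) : qc (n+1) 1 = 1 := by
  have h1 : ((2*n+1).factorial : ℝ) ≠ 0 := by positivity
  have h2 : (n.factorial : ℝ) ≠ 0 := by positivity
  rw [qc, if_pos (by omega)]
  rw [show 2*(n+1)-1 = 2*n+1 by omega, show 2*(n+1) = 2*n+1+1 by ring, show n+1-1 = n by omega,
    Nat.factorial_succ (2*n+1), Nat.factorial_succ n]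
  push_cast
  have h3 : (n:ℝ)+1 ≠ 0 := by positivity
  have h4 : 2*(n:ℝ)+1+1 ≠ 0 := by positivity
  simp only [Nat.factorial_one]
  field_simp
  push_cast; ring

lemma four_ne (n : ℕ) : 4*((n:ℝ)+1)^2-1 ≠ 0 := by
  have : (0:ℝ) ≤ n := by positivity
  nlinarith

lemma qc_ne (n : ℕ) : qc n n ≠ 0 := by
  rw [qc, if_pos le_rfl]; positivity

lemma fac1 (n : ℕ) : ((n+1).factorial : ℝ) = ((n:ℝ)+1) * n.factorial := by
  rw [Nat.factorial_succ]; push_cast; ring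

lemma qc_rec (n k : ℕ) : qc (n+2) (k+2) = qc (n+1) (k+2) + 1/(4*((n:ℝ)+1)^2-1) * qc n k := by
  have hq := four_ne n
  by_cases h : n < k
  · simp [qc, show ¬ (k ≤ n) by omega, show ¬ (k + 2 ≤ n + 1) by omega]
  obtain ⟨d, rfl⟩ : ∃ d, n = k + d := ⟨n - k, by omega⟩
  cases d with
  | zero =>
    have e : 4*((k:ℝ)+1)^2-1 = (2*k+1)*(2*k+3) := by ring
    simp only [add_zero] at hq ⊢
    rw [qc, qc, qc, if_pos (by omega), if_neg (by omega), if_pos (by omega), e]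
    rw [show 2*(k+2) - (k+2) = k+2 by omega, show 2*(k+2) = 2*k+1+1+1+1 by ring,
      show 2*k-k = k by omega, Nat.sub_self, Nat.sub_self]
    simp only [fac1]
    push_cast
    have h1 : ((2*k).factorial : ℝ) ≠ 0 := by positivity
    have h2 : (k.factorial : ℝ) ≠ 0 := by positivity
    field_simp
    ring
  | succ d =>
    have e : 4*(((k+(d+1):ℕ):ℝ)+1)^2-1 = (2*(k+(d+1))+1)*(2*(k+(d+1))+3) := by push_cast; ring
    rw [qc, qc, qc, if_pos (by omega), if_pos (by omega), if_pos (by omega), e]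
    rw [show 2*(k+(d+1)+2) - (k+2) = (k+2*d+2)+1+1 by omega, show 2*(k+(d+1)+2) = 2*(k+(d+1))+1+1+1+1 by ring,
      show 2*(k+(d+1)+1) - (k+2) = k+2*d+2 by omega, show 2*(k+(d+1)+1) = 2*(k+(d+1))+1+1 by ring,
      show 2*(k+(d+1))-k = k+2*d+2 by omega, show k+(d+1)+2-(k+2) = d+1 by omega,
      show k+(d+1)+1-(k+2) = d by omega, show k+(d+1)-k = d+1 by omega]
    have h1 : ((2*(k+(d+1))).factorial : ℝ) ≠ 0 := by positivity
    have h2 : ((k+(d+1)).factorial : ℝ) ≠ 0 := by positivity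
    have h3 : (k.factorial : ℝ) ≠ 0 := by positivity
    have h4 : (d.factorial : ℝ) ≠ 0 := by positivity
    have h5 : ((k+2*d+2).factorial : ℝ) ≠ 0 := by positivity
    rw [fac1 (2*(k+(d+1))+1+1+1), fac1 (2*(k+(d+1))+1+1), fac1 (2*(k+(d+1))+1), fac1 (2*(k+(d+1))),
      fac1 (k+2*d+2+1), fac1 (k+2*d+2), fac1 (k+(d+1)+1), fac1 (k+(d+1)), fac1 d, fac1 (k+1), fac1 k]
    push_cast
    generalize ((2*(k+(d+1))).factorial : ℝ) = f1 at *
    generalize ((k+(d+1)).factorial : ℝ) = f2 at *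
    generalize ((k+2*d+2).factorial : ℝ) = f3 at *
    generalize (k.factorial : ℝ) = f4 at *
    generalize (d.factorial : ℝ) = f5 at *
    field_simp
    ring

lemma besselQ_rec (n : ℕ) (u : ℝ) : besselQ (n+2) u =
    besselQ (n+1) u + u^2/(4*((n:ℝ)+1)^2-1) * besselQ n u := by
  rw [besselQ_eq (n+2) (n+3) (by omega), besselQ_eq (n+1) (n+3) (by omega),
    besselQ_eq n (n+1) (by omega)]
  simp only [Finset.sum_range_succ' _ (n+2), Finset.sum_range_succ' _ (n+1), qc_zero]
  rw [show n + 2 = (n+1)+1 from rfl, zero_add, qc_one, qc_one, show n+1+1 = n+2 from rfl]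
  simp only [show ∀ k, k+1+1 = k+2 from fun _ => rfl, qc_rec]
  simp only [add_mul, Finset.sum_add_distrib, Finset.mul_sum]
  have : ∀ k ∈ range (n+1), 1/(4*((n:ℝ)+1)^2-1) * qc n k * u^(k+2) =
      u^2/(4*((n:ℝ)+1)^2-1) * (qc n k * u^k) := fun k _ => by ring
  rw [Finset.sum_congr rfl this]
  ring

lemma u2q (n : ℕ) (u : ℝ) :
    u^2 * besselQ n u = (4*((n:ℝ)+1)^2-1) * (besselQ (n+2) u - besselQ (n+1) u) := by
  have := four_ne n
  rw [besselQ_rec]; field_simp; ring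

lemma comb (N : ℕ) (b2 b1 b0 : ℕ → ℝ) (c u : ℝ) (h0 : b2 0 = b1 0)
    (h1 : b2 1 = b1 1 - c*3*b0 0)
    (h2 : ∀ k, k ≤ N → b2 (k+2) = b1 (k+2)
      + c*((4*((k:ℝ)+1)^2-1) * b0 k - (4*((k:ℝ)+2)^2-1) * b0 (k+1)))
    (z1 : b1 (N+2) = 0) (z0 : b0 (N+1) = 0) :
    ∑ k ∈ range (N+3), b2 k * besselQ k u = ∑ k ∈ range (N+2), b1 k * besselQ k u
      + c * u^2 * ∑ k ∈ range (N+1), b0 k * besselQ k u := by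
  have e1 : ∑ k ∈ range (N+2), b1 k * besselQ k u = ∑ k ∈ range (N+3), b1 k * besselQ k u := by
    rw [Finset.sum_range_succ _ (N+2), z1]; ring
  have e2 : u^2 * ∑ k ∈ range (N+1), b0 k * besselQ k u =
      ∑ k ∈ range (N+1), b0 k * (4*((k:ℝ)+1)^2-1) * besselQ (k+2) u
      - ∑ k ∈ range (N+1), b0 k * (4*((k:ℝ)+1)^2-1) * besselQ (k+1) u := by
    rw [← Finset.sum_sub_distrib, Finset.mul_sum]
    apply Finset.sum_congr rfl
    intro k _
    linear_combination b0 k * u2q k u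
  have e3 : ∑ k ∈ range (N+1), b0 k * (4*((k:ℝ)+1)^2-1) * besselQ (k+1) u =
      ∑ k ∈ range (N+2), b0 k * (4*((k:ℝ)+1)^2-1) * besselQ (k+1) u := by
    rw [Finset.sum_range_succ _ (N+1), z0]; ring
  rw [e1, mul_assoc, e2, e3]
  simp only [Finset.sum_range_succ' _ (N+2), Finset.sum_range_succ' _ (N+1)]
  have e4 : ∑ k ∈ range (N+1), b2 (k+1+1) * besselQ (k+1+1) u =
      ∑ k ∈ range (N+1), b1 (k+1+1) * besselQ (k+1+1) u +
      c * (∑ k ∈ range (N+1), b0 k * (4*((k:ℝ)+1)^2-1) * besselQ (k+2) u -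
       ∑ k ∈ range (N+1), b0 (k+1) * (4*(((k+1:ℕ):ℝ)+1)^2-1) * besselQ (k+1+1) u) := by
    rw [← Finset.sum_sub_distrib, Finset.mul_sum, ← Finset.sum_add_distrib]
    apply Finset.sum_congr rfl
    intro k hk
    rw [h2 k (by have := Finset.mem_range.1 hk; omega)]
    push_cast
    ring
  rw [e4, h0, zero_add, h1]
  push_cast
  ring

lemma besselQ_indep (N : ℕ) (b : ℕ → ℝ) (h : ∀ u, ∑ k ∈ range N, b k * besselQ k u = 0) :
    ∀ k < N, b k = 0 := by
  induction N with
  | zero => intro k hk; omega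
  | succ N ih =>
    have hN : b N = 0 := by
      let P : Polynomial ℝ := ∑ k ∈ range (N+1), Polynomial.C (b k) *
        ∑ j ∈ range (N+1), Polynomial.C (qc k j) * Polynomial.X ^ j
      have hP : P = 0 := by
        apply Polynomial.funext
        intro u
        rw [Polynomial.eval_zero, ← h u, Polynomial.eval_finsetSum]
        apply Finset.sum_congr rfl
        intro k hk
        rw [besselQ_eq k (N+1) (Finset.mem_range.1 hk)]
        simp [Polynomial.eval_finsetSum]
      have hc := congrArg (fun p => Polynomial.coeff p N) hP
      simp only [P, Polynomial.finsetSum_coeff, Polynomial.coeff_C_mul, Polynomial.coeff_X_pow,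
        Polynomial.coeff_zero, mul_ite, mul_one, mul_zero, Finset.sum_ite_eq, Finset.mem_range,
        Nat.lt_succ_self, if_true] at hc
      rw [Finset.sum_range_succ, Finset.sum_eq_zero] at hc
      · simpa [qc_ne] using hc
      · intro k hk
        rw [qc, if_neg (by have := Finset.mem_range.1 hk; omega)]; simp
    intro k hk
    rcases Nat.lt_succ_iff_lt_or_eq.1 hk with hlt | hlt
    · refine ih (fun u => ?_) k hlt
      have := h u
      rw [Finset.sum_range_succ, hN] at this
      simpa using this
    · rw [hlt, hN]

end BesselAux2

noncomputable section BesselAux3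

def BB (a : ℝ) (n m k : ℕ) : ℝ := if k ≤ n + m then
  poch (1/2) (n+m-k) * poch (1/2) k / (poch (1/2) n * poch (1/2) m) * a^((k:ℤ)-m)
    * (1-a)^((k:ℤ)-n) * cc (1-a) ((n:ℤ)-k-1) (n+m+1) (2*(n+m-k)) else 0

lemma BB_of (a : ℝ) (n m k K : ℕ) (h : n + m = k + K) (p x y : ℤ) (hp : p = (n:ℤ)-k-1)
    (hx : x = (k:ℤ)-m) (hy : y = (k:ℤ)-n) : BB a n m k =
  poch (1/2) K * poch (1/2) k / (poch (1/2) n * poch (1/2) m) * a^x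
    * (1-a)^y * cc (1-a) p (n+m+1) (2*K) := by
  rw [BB, if_pos (by omega), show n+m-k = K by omega, hp, hx, hy]

lemma BB_out (a : ℝ) (n m k : ℕ) (h : n + m < k) : BB a n m k = 0 := by
  rw [BB, if_neg (by omega)]

lemma poch_succ' (x : ℝ) (j : ℕ) : poch x (j+1) = poch x j * (x + j) := by
  simp [poch, Finset.prod_range_succ]

lemma poch_zero' (x : ℝ) : poch x 0 = 1 := by simp [poch]

lemma poch_pos (j : ℕ) : 0 < poch (1/2) j := by
  unfold poch; apply Finset.prod_pos; intro i _; positivity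

lemma four_fac (n : ℕ) : 4*((n:ℝ)+1)^2-1 = 4*(1/2+n)*(1/2+(n+1)) := by ring

lemma recN0 (a : ℝ) (ha1 : 1 - a ≠ 0) (n m : ℕ) :
    BB a (n+2) m 0 = BB a (n+1) m 0 := by
  have key := keyN (1-a) (n:ℤ) (n+m) (n+1+m) (n+1) 0 (by push_cast; ring) (by push_cast; ring)
  rw [show ((n:ℤ)+1) = ((n+1:ℕ):ℤ) by push_cast; ring, cc_vanish _ (n+1) (n+m+1) _ (by omega),
    cc_vanish _ n (n+m+1) _ (by omega)] at key
  rw [BB_of a (n+2) m 0 (n+1+m+1) (by omega) ((n+1:ℕ):ℤ) (-m) (-n-2) (by push_cast; ring)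
      (by push_cast; ring) (by push_cast; ring),
    BB_of a (n+1) m 0 (n+1+m) (by omega) (n:ℤ) (-m) (-n-2+1) (by push_cast; ring)
      (by push_cast; ring) (by push_cast; ring), zpow_add₀ ha1, zpow_one]
  rw [show n+2+m+1 = n+m+3 by ring, show n+1+m+1 = n+m+2 by ring,
    show 2*(n+m+2) = 2*(n+1+m)+2 by ring, show n+m+2 = (n+1+m)+1 by ring,
    poch_succ' _ (n+1+m), poch_succ' _ (n+1)]
  rw [show n+1+m+1 = n+m+2 by ring]
  have := (poch_pos (n+1)).ne'
  have := (poch_pos m).ne'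
  have h3 : (1/2+((n+1:ℕ):ℝ)) ≠ 0 := by positivity
  push_cast at key h3 ⊢
  field_simp
  linear_combination 2 * poch (1/2) (n+1+m) * poch (1/2) 0 * a^(-(m:ℤ)) * key

lemma recN1 (a : ℝ) (ha : a ≠ 0) (ha1 : 1 - a ≠ 0) (n m : ℕ) :
    BB a (n+2) m 1 = BB a (n+1) m 1 - a^2/(4*((n:ℝ)+1)^2-1) * 3 * BB a n m 0 := by
  have key := keyN (1-a) ((n:ℤ)-1) (n+m) (n+m) (n+1) 1 (by push_cast; ring) (by push_cast; ring)
  rw [sub_add_cancel, cc_vanish _ n (n+m+1) _ (by omega)] at key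
  rw [BB_of a (n+2) m 1 (n+m+1) (by omega) (n:ℤ) (-m+1) (-n-1) (by push_cast; ring)
      (by push_cast; ring) (by push_cast; ring),
    BB_of a (n+1) m 1 (n+m) (by omega) ((n:ℤ)-1) (-m+1) (-n-1+1) (by push_cast; ring)
      (by push_cast; ring) (by push_cast; ring),
    BB_of a n m 0 (n+m) (by omega) ((n:ℤ)-1) (-m) (-n-1+1) (by push_cast; ring)
      (by push_cast; ring) (by push_cast; ring),
    zpow_add₀ ha1, zpow_one, zpow_add₀ ha, zpow_one, four_fac]
  rw [show n+2+m+1 = n+m+3 by ring, show n+1+m+1 = n+m+2 by ring,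
    show 2*(n+m+1) = 2*(n+m)+2 by ring,
    poch_succ' _ (n+m), poch_succ' _ (n+1), poch_succ' _ n, poch_succ' _ 0, poch_zero']
  have := (poch_pos n).ne'
  have := (poch_pos m).ne'
  push_cast at key ⊢
  have h3 : (1/2+(n:ℝ)) ≠ 0 := by positivity
  have h4 : (1/2+((n:ℝ)+1)) ≠ 0 := by positivity
  generalize cc (1 - a) n (n + m + 3) (2 * (n + m) + 2) = c1 at *
  generalize cc (1 - a) (n-1) (n + m + 2) (2 * (n + m)) = c2 at *
  generalize cc (1 - a) (n-1) (n + m + 1) (2 * (n + m)) = c4 at *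
  generalize poch (1/2) (n+m) = P1 at *
  generalize poch (1/2) n = P2 at *
  generalize poch (1/2) m = P3 at *
  have hc : (1/2+((n:ℝ)+m)) * c1 = (1-a)*(1/2+(n+1))*c2 - (1-a)*a*(3/2)*c4 := by
    linear_combination key
  generalize (1/2+(n:ℝ)) = r1 at *
  generalize (1/2+((n:ℝ)+1)) = r2 at *
  generalize (1/2+((n:ℝ)+m)) = r3 at *
  field_simp
  linear_combination 4 * P1 * hc

lemma recN2 (a : ℝ) (ha : a ≠ 0) (ha1 : 1 - a ≠ 0) (n m k : ℕ) (hk : k ≤ n + m) :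
    BB a (n+2) m (k+2) = BB a (n+1) m (k+2) + a^2/(4*((n:ℝ)+1)^2-1) *
      ((4*((k:ℝ)+1)^2-1) * BB a n m k - (4*((k:ℝ)+2)^2-1) * BB a n m (k+1)) := by
  have h3 : (1/2+(n:ℝ)) ≠ 0 := by positivity
  have h4 : (1/2+((n:ℝ)+1)) ≠ 0 := by positivity
  have h5 := (poch_pos n).ne'
  have h6 := (poch_pos m).ne'
  rcases Nat.eq_or_lt_of_le hk with h | h
  · rw [BB_out a (n+1) m (k+2) (by omega), BB_out a n m (k+1) (by omega),
      BB_of a (n+2) m (k+2) 0 (by omega) ((n:ℤ)-k-1) (k-m+2) (k-n) (by push_cast; ring)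
      (by push_cast; ring) (by push_cast; ring),
      BB_of a n m k 0 (by omega) ((n:ℤ)-k-1) (k-m) (k-n) (by push_cast; ring)
      (by push_cast; ring) (by push_cast; ring), zpow_add₀ ha, mul_zero, cc_top, cc_top,
      four_fac, four_fac, poch_succ' _ (k+1), poch_succ' _ k, poch_succ' _ (n+1), poch_succ' _ n]
    push_cast
    have e : a^(2:ℤ) = a^2 := by norm_cast
    rw [e]
    generalize (1/2+(n:ℝ)) = r1 at *
    generalize (1/2+((n:ℝ)+1)) = r2 at *
    field_simp
    ring
  · obtain ⟨L, hL⟩ : ∃ L, n + m = k + 1 + L := ⟨n+m-k-1, by omega⟩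
    have hL' : (n:ℝ) + m = k + 1 + L := by exact_mod_cast hL
    have key := keyN (1-a) ((n:ℤ)-k-2) (n+m) L (n+1) (k+2) (by push_cast; linarith)
      (by push_cast; ring)
    rw [show (n:ℤ)-k-2+1 = n-k-1 by ring] at key
    rw [BB_of a (n+2) m (k+2) (L+1) (by omega) ((n:ℤ)-k-1) (k-m+2) (k-n) (by push_cast; ring)
      (by push_cast; ring) (by push_cast; ring),
      BB_of a (n+1) m (k+2) L (by omega) ((n:ℤ)-k-2) (k-m+2) (k-n+1) (by push_cast; ring)
      (by push_cast; ring) (by push_cast; ring),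
      BB_of a n m k (L+1) (by omega) ((n:ℤ)-k-1) (k-m) (k-n) (by push_cast; ring)
      (by push_cast; ring) (by push_cast; ring),
      BB_of a n m (k+1) L (by omega) ((n:ℤ)-k-2) (k-m+1) (k-n+1) (by push_cast; ring)
      (by push_cast; ring) (by push_cast; ring),
      zpow_add₀ ha, zpow_add₀ ha, zpow_add₀ ha1, zpow_one, zpow_one,
      four_fac, four_fac, show 4*((k:ℝ)+2)^2-1 = 4*(1/2+(k+1))*(1/2+(k+2)) by ring,
      poch_succ' _ (k+1), poch_succ' _ k, poch_succ' _ (n+1), poch_succ' _ n, poch_succ' _ L,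
      show n+2+m+1 = n+m+3 by ring, show n+1+m+1 = n+m+2 by ring, show 2*(L+1) = 2*L+2 by ring]
    push_cast
    have e : a^(2:ℤ) = a^2 := by norm_cast
    rw [e]
    generalize cc (1 - a) ((n:ℤ)-k-1) (n + m + 3) (2 * L + 2) = c1 at *
    generalize cc (1 - a) ((n:ℤ)-k-2) (n + m + 2) (2 * L) = c2 at *
    generalize cc (1 - a) ((n:ℤ)-k-1) (n + m + 1) (2 * L + 2) = c3 at *
    generalize cc (1 - a) ((n:ℤ)-k-2) (n + m + 1) (2 * L) = c4 at *
    have hc : (1/2+(L:ℝ)) * c1 = (1-a)*(1/2+(n+1))*c2 + (1/2+(L:ℝ))*c3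
        - (1-a)*a*(1/2+(k+2))*c4 := by
      linear_combination key
    generalize poch (1/2) n = P2 at *
    generalize poch (1/2) m = P3 at *
    generalize (1/2+(n:ℝ)) = r1 at *
    generalize (1/2+((n:ℝ)+1)) = r2 at *
    generalize (1/2+(L:ℝ)) = r3 at *
    generalize (1/2+((k:ℝ)+2)) = r4 at *
    generalize (1/2+((k:ℝ)+1)) = r5 at *
    generalize (1/2+(k:ℝ)) = r6 at *
    field_simp
    linear_combination poch (1/2) L * poch (1/2) k * r6 * r5 * hc

lemma recM0 (a : ℝ) (ha : a ≠ 0) (n m : ℕ) :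
    BB a n (m+2) 0 = BB a n (m+1) 0 := by
  have key := keyM (1-a) ((n:ℤ)-1) (n+m) (n+1+m) n 0 (m+1) (by push_cast; ring) (by push_cast; ring) (by push_cast; ring)
  rw [show ((n:ℤ)-1+1) = n by ring, show ((n:ℤ)-1+2) = ((n+1:ℕ):ℤ) by push_cast; ring,
    cc_vanish _ (n+1) (n+m+1) _ (by omega),
    cc_vanish _ n (n+m+1) _ (by omega)] at key
  rw [BB_of a n (m+2) 0 (n+1+m+1) (by omega) ((n:ℤ)-1) (-m-2) (-n) (by push_cast; ring)
      (by push_cast; ring) (by push_cast; ring),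
    BB_of a n (m+1) 0 (n+1+m) (by omega) ((n:ℤ)-1) (-m-2+1) (-n) (by push_cast; ring)
      (by push_cast; ring) (by push_cast; ring), zpow_add₀ ha, zpow_one]
  rw [show n+(m+2)+1 = n+m+3 by ring, show n+(m+1)+1 = n+m+2 by ring,
    show 2*(n+1+m+1) = 2*(n+1+m)+2 by ring,
    poch_succ' _ (n+1+m), poch_succ' _ (m+1)]
  have := (poch_pos n).ne'
  have := (poch_pos (m+1)).ne'
  have h3 : (1/2+((m+1:ℕ):ℝ)) ≠ 0 := by positivity
  push_cast at key h3 ⊢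
  field_simp
  linear_combination 2 * poch (1/2) (n+1+m) * poch (1/2) 0 * (1-a)^(-(n:ℤ)) * key

lemma recM1 (a : ℝ) (ha : a ≠ 0) (ha1 : 1 - a ≠ 0) (n m : ℕ) :
    BB a n (m+2) 1 = BB a n (m+1) 1 - (1-a)^2/(4*((m:ℝ)+1)^2-1) * 3 * BB a n m 0 := by
  have key := keyM (1-a) ((n:ℤ)-2) (n+m) (n+m) n 1 (m+1) (by push_cast; ring) (by push_cast; ring) (by push_cast; ring)
  rw [show ((n:ℤ)-2+1) = n-1 by ring, sub_add_cancel, cc_vanish _ n (n+m+1) _ (by omega)] at key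
  rw [BB_of a n (m+2) 1 (n+m+1) (by omega) ((n:ℤ)-2) (-m-1) (-n+1) (by push_cast; ring)
      (by push_cast; ring) (by push_cast; ring),
    BB_of a n (m+1) 1 (n+m) (by omega) ((n:ℤ)-2) (-m-1+1) (-n+1) (by push_cast; ring)
      (by push_cast; ring) (by push_cast; ring),
    BB_of a n m 0 (n+m) (by omega) ((n:ℤ)-1) (-m-1+1) (-n) (by push_cast; ring)
      (by push_cast; ring) (by push_cast; ring),
    zpow_add₀ ha1, zpow_one, zpow_add₀ ha, zpow_one, four_fac]
  rw [show n+(m+2)+1 = n+m+3 by ring, show n+(m+1)+1 = n+m+2 by ring,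
    show 2*(n+m+1) = 2*(n+m)+2 by ring,
    poch_succ' _ (n+m), poch_succ' _ (m+1), poch_succ' _ m, poch_succ' _ 0, poch_zero']
  have := (poch_pos n).ne'
  have := (poch_pos m).ne'
  push_cast at key ⊢
  have h3 : (1/2+(m:ℝ)) ≠ 0 := by positivity
  have h4 : (1/2+((m:ℝ)+1)) ≠ 0 := by positivity
  generalize cc (1 - a) (n-2) (n + m + 3) (2 * (n + m) + 2) = c1 at *
  generalize cc (1 - a) (n-2) (n + m + 2) (2 * (n + m)) = c2 at *
  generalize cc (1 - a) (n-1) (n + m + 1) (2 * (n + m)) = c4 at *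
  generalize poch (1/2) (n+m) = P1 at *
  generalize poch (1/2) n = P2 at *
  generalize poch (1/2) m = P3 at *
  have hc : (1/2+((n:ℝ)+m)) * c1 = a*(1/2+(m+1))*c2 - (1-a)*a*(3/2)*c4 := by
    linear_combination key
  generalize (1/2+(m:ℝ)) = r1 at *
  generalize (1/2+((m:ℝ)+1)) = r2 at *
  generalize (1/2+((n:ℝ)+m)) = r3 at *
  field_simp
  linear_combination 4 * P1 * hc

lemma recM2 (a : ℝ) (ha : a ≠ 0) (ha1 : 1 - a ≠ 0) (n m k : ℕ) (hk : k ≤ n + m) :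
    BB a n (m+2) (k+2) = BB a n (m+1) (k+2) + (1-a)^2/(4*((m:ℝ)+1)^2-1) *
      ((4*((k:ℝ)+1)^2-1) * BB a n m k - (4*((k:ℝ)+2)^2-1) * BB a n m (k+1)) := by
  have h3 : (1/2+(m:ℝ)) ≠ 0 := by positivity
  have h4 : (1/2+((m:ℝ)+1)) ≠ 0 := by positivity
  have h5 := (poch_pos n).ne'
  have h6 := (poch_pos m).ne'
  rcases Nat.eq_or_lt_of_le hk with h | h
  · rw [BB_out a n (m+1) (k+2) (by omega), BB_out a n m (k+1) (by omega),
      BB_of a n (m+2) (k+2) 0 (by omega) ((n:ℤ)-k-3) (k-m) (k-n+2) (by push_cast; ring)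
      (by push_cast; ring) (by push_cast; ring),
      BB_of a n m k 0 (by omega) ((n:ℤ)-k-1) (k-m) (k-n) (by push_cast; ring)
      (by push_cast; ring) (by push_cast; ring), zpow_add₀ ha1, mul_zero, cc_top, cc_top,
      four_fac, four_fac, poch_succ' _ (k+1), poch_succ' _ k, poch_succ' _ (m+1), poch_succ' _ m]
    push_cast
    have e : (1-a)^(2:ℤ) = (1-a)^2 := by norm_cast
    rw [e]
    generalize (1/2+(m:ℝ)) = r1 at *
    generalize (1/2+((m:ℝ)+1)) = r2 at *
    field_simp
    ring
  · obtain ⟨L, hL⟩ : ∃ L, n + m = k + 1 + L := ⟨n+m-k-1, by omega⟩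
    have hL' : (n:ℝ) + m = k + 1 + L := by exact_mod_cast hL
    have key := keyM (1-a) ((n:ℤ)-k-3) (n+m) L n (k+2) (m+1) (by push_cast; linarith)
      (by push_cast; ring) (by push_cast; ring)
    rw [show (n:ℤ)-k-3+1 = n-k-2 by ring, show (n:ℤ)-k-3+2 = n-k-1 by ring] at key
    rw [BB_of a n (m+2) (k+2) (L+1) (by omega) ((n:ℤ)-k-3) (k-m) (k-n+2) (by push_cast; ring)
      (by push_cast; ring) (by push_cast; ring),
      BB_of a n (m+1) (k+2) L (by omega) ((n:ℤ)-k-3) (k-m+1) (k-n+2) (by push_cast; ring)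
      (by push_cast; ring) (by push_cast; ring),
      BB_of a n m k (L+1) (by omega) ((n:ℤ)-k-1) (k-m) (k-n) (by push_cast; ring)
      (by push_cast; ring) (by push_cast; ring),
      BB_of a n m (k+1) L (by omega) ((n:ℤ)-k-2) (k-m+1) (k-n+1) (by push_cast; ring)
      (by push_cast; ring) (by push_cast; ring),
      zpow_add₀ ha1, zpow_add₀ ha1, zpow_add₀ ha, zpow_one, zpow_one,
      four_fac, four_fac, show 4*((k:ℝ)+2)^2-1 = 4*(1/2+(k+1))*(1/2+(k+2)) by ring,
      poch_succ' _ (k+1), poch_succ' _ k, poch_succ' _ (m+1), poch_succ' _ m, poch_succ' _ L,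
      show n+(m+2)+1 = n+m+3 by ring, show n+(m+1)+1 = n+m+2 by ring, show 2*(L+1) = 2*L+2 by ring]
    push_cast
    have e : (1-a)^(2:ℤ) = (1-a)^2 := by norm_cast
    rw [e]
    generalize cc (1 - a) ((n:ℤ)-k-3) (n + m + 3) (2 * L + 2) = c1 at *
    generalize cc (1 - a) ((n:ℤ)-k-3) (n + m + 2) (2 * L) = c2 at *
    generalize cc (1 - a) ((n:ℤ)-k-1) (n + m + 1) (2 * L + 2) = c3 at *
    generalize cc (1 - a) ((n:ℤ)-k-2) (n + m + 1) (2 * L) = c4 at *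
    have hc : (1/2+(L:ℝ)) * c1 = a*(1/2+(m+1))*c2 + (1/2+(L:ℝ))*c3
        - (1-a)*a*(1/2+(k+2))*c4 := by
      linear_combination key
    generalize poch (1/2) n = P2 at *
    generalize poch (1/2) m = P3 at *
    generalize (1/2+(m:ℝ)) = r1 at *
    generalize (1/2+((m:ℝ)+1)) = r2 at *
    generalize (1/2+(L:ℝ)) = r3 at *
    generalize (1/2+((k:ℝ)+2)) = r4 at *
    generalize (1/2+((k:ℝ)+1)) = r5 at *
    generalize (1/2+(k:ℝ)) = r6 at *
    field_simp
    linear_combination poch (1/2) L * poch (1/2) k * r6 * r5 * hc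

end BesselAux3

noncomputable section BesselAux4

def PP (a : ℝ) (n m : ℕ) : Prop := ∀ u : ℝ, besselQ n (a * u) * besselQ m ((1 - a) * u) =
      ∑ k ∈ Finset.range (n + m + 1), BB a n m k * besselQ k u

lemma stepN (a : ℝ) (ha : a ≠ 0) (ha1 : 1 - a ≠ 0) (n m : ℕ) (h0 : PP a n m)
    (h1 : PP a (n+1) m) : PP a (n+2) m := by
  intro u
  have := comb (n+m) (BB a (n+2) m) (BB a (n+1) m) (BB a n m) (a^2/(4*((n:ℝ)+1)^2-1)) u
    (recN0 a ha1 n m) (recN1 a ha ha1 n m) (fun k hk => recN2 a ha ha1 n m k hk)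
    (BB_out _ _ _ _ (by omega)) (BB_out _ _ _ _ (by omega))
  have h0 := h0 u
  have h1 := h1 u
  rw [show n+1+m+1 = n+m+2 by ring] at h1
  rw [show n+2+m+1 = n+m+3 by ring, this, ← h0, ← h1, besselQ_rec]
  ring

lemma stepM (a : ℝ) (ha : a ≠ 0) (ha1 : 1 - a ≠ 0) (n m : ℕ) (h0 : PP a n m)
    (h1 : PP a n (m+1)) : PP a n (m+2) := by
  intro u
  have := comb (n+m) (BB a n (m+2)) (BB a n (m+1)) (BB a n m) ((1-a)^2/(4*((m:ℝ)+1)^2-1)) u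
    (recM0 a ha n m) (recM1 a ha ha1 n m) (fun k hk => recM2 a ha ha1 n m k hk)
    (BB_out _ _ _ _ (by omega)) (BB_out _ _ _ _ (by omega))
  have h0 := h0 u
  have h1 := h1 u
  rw [show n+(m+1)+1 = n+m+2 by ring] at h1
  rw [show n+(m+2)+1 = n+m+3 by ring, this, ← h0, ← h1, besselQ_rec]
  ring

lemma q0 (u : ℝ) : besselQ 0 u = 1 := by simp [besselQ]

lemma q1 (u : ℝ) : besselQ 1 u = 1 + u := by
  simp [besselQ, Finset.sum_range_succ, Nat.factorial]

lemma q2 (u : ℝ) : besselQ 2 u = 1 + u + u^2/3 := by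
  have := besselQ_rec 0 u
  norm_num at this
  rw [this, q1, q0]; ring

lemma base00 (a : ℝ) : PP a 0 0 := by
  intro u
  simp [BB, cc_top, poch, q0]

lemma base10 (a : ℝ) (ha1 : 1 - a ≠ 0) : PP a 1 0 := by
  intro u
  simp [BB, cc_sum, poch, q0, q1, Finset.sum_range_succ, gbinom, Finset.prod_range_succ]
  field_simp
  ring

lemma base01 (a : ℝ) (ha : a ≠ 0) : PP a 0 1 := by
  intro u
  simp [BB, cc_sum, poch, q0, q1, Finset.sum_range_succ, gbinom, Finset.prod_range_succ]
  field_simp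
  ring

lemma base11 (a : ℝ) (ha : a ≠ 0) (ha1 : 1 - a ≠ 0) : PP a 1 1 := by
  intro u
  simp [BB, cc_sum, poch, q0, q1, q2, Finset.sum_range_succ, gbinom, Finset.prod_range_succ]
  field_simp
  ring

lemma PP_all (a : ℝ) (ha : a ≠ 0) (ha1 : 1 - a ≠ 0) (n m : ℕ) : PP a n m := by
  have A : ∀ m, PP a 0 m → PP a 1 m → ∀ n, PP a n m := by
    intro m h0 h1 n
    have : PP a n m ∧ PP a (n+1) m := by
      induction n with
      | zero => exact ⟨h0, h1⟩
      | succ n ih => exact ⟨ih.2, stepN a ha ha1 n m ih.1 ih.2⟩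
    exact this.1
  have h0 := A 0 (base00 a) (base10 a ha1) n
  have h1 := A 1 (base01 a ha) (base11 a ha ha1) n
  have : PP a n m ∧ PP a n (m+1) := by
    induction m with
    | zero => exact ⟨h0, h1⟩
    | succ m ih => exact ⟨ih.2, stepM a ha ha1 n m ih.1 ih.2⟩
  exact this.1

lemma choose_poch (M j : ℕ) :
    (M.choose j : ℝ) = (-1)^j * poch (-(M:ℝ)) j / j.factorial := by
  induction j with
  | zero => simp [poch]
  | succ j ih =>
    have h : (M.choose (j+1) : ℝ) * (j+1) = M.choose j * ((M:ℝ) - j) := by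
      rcases le_or_gt j M with h | h
      · have := Nat.choose_succ_right_eq M j
        rw [← Nat.cast_sub h]; exact_mod_cast this
      · rw [Nat.choose_eq_zero_of_lt h, Nat.choose_eq_zero_of_lt (by omega)]; simp
    have h2 : (j:ℝ)+1 ≠ 0 := by positivity
    have h3 : (j.factorial : ℝ) ≠ 0 := by positivity
    apply mul_right_cancel₀ h2
    rw [h, ih, poch_succ', fac1]
    field_simp
    ring

lemma gbinom_shift (p : ℤ) (r j : ℕ) :
    gbinom p (r+j) = gbinom p r * ((-1)^j * poch ((r:ℝ)-p) j / poch ((r:ℝ)+1) j) := by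
  induction j with
  | zero => simp [poch]
  | succ j ih =>
    have h2 : (r:ℝ)+j+1 ≠ 0 := by positivity
    have h3 : poch ((r:ℝ)+1) j ≠ 0 := by
      unfold poch; apply ne_of_gt; apply Finset.prod_pos; intro i _; positivity
    have h := gbinom_succ_mul p (r+j)
    have h4 : (r:ℝ)+1+j ≠ 0 := by positivity
    push_cast at h
    apply mul_right_cancel₀ h2
    rw [← add_assoc, h, ih, poch_succ', poch_succ']
    field_simp
    ring

lemma cc_final (s : ℝ) (hs : s ≠ 0) (p : ℤ) (M r : ℕ) :
    cc s p M (r + M) = s^M * gbinom p r * ∑ j ∈ range (M+1),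
      poch (-(M:ℝ)) j * poch ((r:ℝ)-p) j / (poch ((r:ℝ)+1) j * j.factorial) * s^(-(j:ℤ)) := by
  rw [cc_sum, Finset.mul_sum]
  rw [← Finset.sum_subset (Finset.range_subset_range.2 (show M+1 ≤ r+M+1 by omega))]
  · rw [← Finset.sum_range_reflect]
    apply Finset.sum_congr rfl
    intro j hj
    have hj : j ≤ M := by have := Finset.mem_range.1 hj; omega
    rw [show M+1-1-j = M-j by omega, Nat.choose_symm hj, show r+M-(M-j) = r+j by omega,
      gbinom_shift, choose_poch]
    have e : s^(M-j) = s^M * s^(-(j:ℤ)) := by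
      rw [← zpow_natCast, ← zpow_natCast, ← zpow_add₀ hs]; congr 1; push_cast [hj]; ring
    rw [e]
    have e2 : ((-1:ℝ)^j)*(-1)^j = 1 := by rw [← mul_pow]; simp
    linear_combination (poch (-(M:ℝ)) j * poch ((r:ℝ)-p) j / (poch ((r:ℝ)+1) j * j.factorial)
      * s^(-(j:ℤ)) * s^M * gbinom p r) * e2
  · intro j _ hj
    rw [Nat.choose_eq_zero_of_lt (by simpa using hj)]; simp

end BesselAux4

theorem bessel_linearization_lower_2F1_transformed
    (n m : ℕ) (hnm : 1 ≤ n + m) (a : ℝ) (ha : a ≠ 0) (ha1 : a ≠ 1)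
    (β : ℕ → ℝ)
    (hβ : ∀ u : ℝ, besselQ n (a * u) * besselQ m ((1 - a) * u) =
      ∑ k ∈ Finset.range (n + m + 1), β k * besselQ k u)
    (k : ℕ) (hk : k ≤ (n + m - 1) / 2) :
    β k = a ^ ((k : ℤ) - m) * (1 - a) ^ (m + k + 1) *
      (poch (1/2) (n + m - k) * poch (1/2) k) / (poch (1/2) n * poch (1/2) m) *
      gbinom ((n : ℤ) - k - 1) (n + m - 2 * k - 1) *
      ∑ j ∈ Finset.range (n + m + 1 + 1),
        poch (-(m : ℝ) - n - 1) j * poch ((m : ℝ) - k) j /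
          (poch ((n : ℝ) + m - 2 * k) j * j.factorial) * (1 - a) ^ (-(j : ℤ)) := by
  have hs : 1 - a ≠ 0 := sub_ne_zero.2 (Ne.symm ha1)
  have hP := PP_all a ha hs n m
  have h0 := besselQ_indep (n+m+1) (fun k => β k - BB a n m k) (fun u => by
    simp only [sub_mul, Finset.sum_sub_distrib]
    rw [← hβ u, ← hP u, sub_self]) k (by omega)
  rw [sub_eq_zero.1 h0]
  obtain ⟨r, hr⟩ : ∃ r, n + m = 2*k + 1 + r := ⟨n+m-2*k-1, by omega⟩
  have hr' : (n:ℝ) + m = 2*k+1+r := by exact_mod_cast hr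
  rw [BB, if_pos (by omega), show 2*(n+m-k) = r + (n+m+1) by omega, cc_final _ hs,
    show n+m-2*k-1 = r by omega]
  have e1 : -(((n+m+1:ℕ)):ℝ) = -(m:ℝ)-n-1 := by push_cast; ring
  have e2 : (r:ℝ) - (((n:ℤ)-k-1 : ℤ):ℝ) = m - k := by push_cast; linarith
  have e3 : (r:ℝ) + 1 = n + m - 2*k := by linarith
  rw [e1, e2, e3]
  have e4 : (1-a)^(m+k+1) = (1-a)^((k:ℤ)-n) * (1-a)^(n+m+1) := by
    rw [← zpow_natCast, ← zpow_natCast, ← zpow_add₀ hs]; congr 1; push_cast; ring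
  rw [e4]
  ring
end

section
/- (Student t convolution identity) Let n, m be natural numbers and let a be a real number with 0 < a < 1. For a natural number j, let f_{j+1/2} : ℝ → ℝ be the Student t density with 2j+1 degrees of freedom, f_{j+1/2}(x) = A_{j+1/2}/(1+x²)^{j+1} with A_{j+1/2} = j!/(π · (1/2)_j). Then for every real x, ∫_{−∞}^{∞} (1/(a(1−a))) · f_{n+1/2}(y/a) · f_{m+1/2}((x−y)/(1−a)) dy = Σ_{k=0}^{n+m} β_k^{(n,m)}(a) · f_{k+1/2}(x). -/
open Finset

open Real MeasureTheory

/-- The Student t density with `2j+1` degrees of freedom. -/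
noncomputable def studentDensity (j : ℕ) (x : ℝ) : ℝ :=
  ((j.factorial : ℝ) / (π * poch (1/2) j)) / (1 + x ^ 2) ^ (j + 1)

theorem expAbs_integrable (k : ℕ) : Integrable (fun t : ℝ => Real.exp (-|t|) * |t| ^ k) := by
  have h := integrable_of_isBigO_exp_neg (a := 0) (b := 1/2) (f := fun t : ℝ => Real.exp (-t) * t ^ k) (by norm_num)
    (by fun_prop) (by
      have := (tendsto_pow_mul_exp_neg_atTop_nhds_zero k).comp
        (Filter.tendsto_id.const_mul_atTop (show (0:ℝ) < 1/2 by norm_num))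
      refine Asymptotics.isBigO_of_div_tendsto_nhds (.of_forall fun x hx => absurd hx (Real.exp_pos _).ne') 0 ?_
      have h2 := this.const_mul (2 ^ k)
      simp only [mul_zero] at h2
      refine h2.congr fun x => ?_
      simp only [Function.comp, id, Pi.div_apply]
      rw [eq_div_iff (Real.exp_pos _).ne', mul_assoc, mul_assoc, ← Real.exp_add, ← mul_assoc, ← mul_pow,
        mul_comm]
      congr 2 <;> ring)
  have h1 : IntegrableOn (fun t : ℝ => Real.exp (-|t|) * |t| ^ k) (Set.Ioi 0) :=
    h.congr_fun (fun t ht => by simp only [abs_of_pos (Set.mem_Ioi.1 ht)]) measurableSet_Ioi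
  have h2 : IntegrableOn (fun t : ℝ => Real.exp (-|t|) * |t| ^ k) (Set.Iio 0) := by
    have := ((integrable_indicator_iff measurableSet_Ioi).2 h1).comp_neg
    rw [← integrable_indicator_iff measurableSet_Iio]
    refine this.congr (.of_forall fun t => ?_)
    simp [Set.indicator]
  have h3 := ((integrableOn_Iic_iff_integrableOn_Iio (by simp)).2 h2).union h1
  rwa [Set.Iic_union_Ioi, integrableOn_univ] at h3

theorem laplace_integrable (k : ℕ) (x : ℝ) :
    IntegrableOn (fun t : ℝ => (t : ℂ) ^ k * Complex.exp (-(1 + x * Complex.I) * t)) (Set.Ioi 0) := by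
  refine (expAbs_integrable k).integrableOn.mono' (by
    apply Continuous.aestronglyMeasurable; fun_prop) ?_
  refine (ae_restrict_iff' measurableSet_Ioi).2 (.of_forall fun t ht => ?_)
  simp [Complex.norm_exp, abs_of_pos (Set.mem_Ioi.1 ht), mul_comm]

theorem laplace_moment (k : ℕ) (x : ℝ) :
    ∫ t in Set.Ioi (0:ℝ), (t : ℂ) ^ k * Complex.exp (-(1 + x * Complex.I) * t) =
      k.factorial / (1 + x * Complex.I) ^ (k + 1) := by
  have hc : (1 + x * Complex.I : ℂ) ≠ 0 := by
    intro h; have := congrArg Complex.re h; simp at this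
  induction k with
  | zero =>
    have := integral_exp_mul_complex_Ioi (a := -(1 + x * Complex.I)) (by simp) 0
    simp only [pow_zero, one_mul, this]
    simp [neg_div, div_neg, -neg_add_rev]
  | succ k ih =>
    have key := integral_Ioi_of_hasDerivAt_of_tendsto' (a := (0:ℝ)) (m := (0:ℂ))
      (f := fun t : ℝ => (t : ℂ) ^ (k+1) * Complex.exp (-(1 + x * Complex.I) * t))
      (f' := fun t : ℝ => (k+1) * ((t : ℂ) ^ k * Complex.exp (-(1 + x * Complex.I) * t))
        - (1 + x * Complex.I) * ((t : ℂ) ^ (k+1) * Complex.exp (-(1 + x * Complex.I) * t)))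
      (fun t _ => by
        have h1 : HasDerivAt (fun t : ℝ => (t : ℂ)) 1 t := Complex.ofRealCLM.hasDerivAt
        have h2 := (h1.pow (k+1)).mul ((h1.const_mul (-(1 + x * Complex.I))).cexp)
        refine h2.congr_deriv ?_
        simp only [Pi.pow_apply, Nat.add_sub_cancel]
        push_cast; ring)
      (((laplace_integrable k x).const_mul _).sub ((laplace_integrable (k+1) x).const_mul _))
      (by
        rw [tendsto_zero_iff_norm_tendsto_zero]
        refine (tendsto_pow_mul_exp_neg_atTop_nhds_zero (k+1)).congr' ?_
        filter_upwards [Filter.eventually_gt_atTop 0] with t ht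
        simp [Complex.norm_exp, abs_of_pos ht])
    rw [integral_sub ((laplace_integrable k x).const_mul _) ((laplace_integrable (k+1) x).const_mul _),
      integral_const_mul, integral_const_mul, ih] at key
    have h3 : (k+1 : ℂ) * (k.factorial / (1 + x * Complex.I) ^ (k + 1)) =
      (1 + x * Complex.I) * ∫ t in Set.Ioi (0:ℝ), (t : ℂ) ^ (k+1) * Complex.exp (-(1 + x * Complex.I) * t) := by
      simpa [sub_eq_zero] using key
    rw [← mul_right_inj' hc, ← h3, Nat.factorial_succ]
    push_cast; field_simp; ring

theorem chaundy_bullard (p q : ℂ) (h : p + q = 1) (j : ℕ) :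
    ∑ l ∈ Finset.range (j+1), ((j + l).choose l : ℂ) * (p ^ l * q ^ (j+1) + q ^ l * p ^ (j+1)) = 1 := by
  have aux : ∀ p : ℂ, ∀ j b : ℕ,
      (1 - p) * ∑ l ∈ Finset.range (b+1), ((j + 1 + l).choose l : ℂ) * p ^ l =
      ∑ l ∈ Finset.range (b+1), ((j + l).choose l : ℂ) * p ^ l
        - ((j + 1 + b).choose b : ℂ) * p ^ (b+1) := by
    intro p j b
    induction b with
    | zero => simp
    | succ b ih =>
      rw [Finset.sum_range_succ, mul_add, ih, Finset.sum_range_succ _ (b+1)]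
      have : (j + 1 + (b + 1)).choose (b+1) = (j+1+b).choose b + (j + (b+1)).choose (b+1) := by
        rw [show j + 1 + (b+1) = (j+1+b) + 1 by ring, Nat.choose_succ_succ,
          show j + (b+1) = j+1+b by ring]
      rw [this]; push_cast; ring
  have step : ∀ p q : ℂ, p + q = 1 → ∀ j : ℕ,
      q ^ (j+2) * ∑ l ∈ Finset.range (j+2), ((j + 1 + l).choose l : ℂ) * p ^ l =
      q ^ (j+1) * ∑ l ∈ Finset.range (j+1), ((j + l).choose l : ℂ) * p ^ l
       + ((j + (j + 1)).choose (j+1) : ℂ) * (p * q) ^ (j+1) * (1 - 2 * p) := by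
    intro p q h j
    have hq : q = 1 - p := by linear_combination h
    have := aux p j (j+1)
    rw [pow_succ, mul_assoc, ← hq] at *
    rw [this, Finset.sum_range_succ _ (j+1)]
    have h2 : (j + 1 + (j + 1)).choose (j+1) = 2 * (j + (j+1)).choose (j+1) := by
      rw [show j + 1 + (j+1) = (j+(j+1)) + 1 by ring, Nat.choose_succ_succ,
        Nat.choose_symm_of_eq_add (show j + (j+1) = j + (j+1) from rfl)]
      ring
    rw [h2]; push_cast; ring
  have main : q ^ (j+1) * ∑ l ∈ Finset.range (j+1), ((j + l).choose l : ℂ) * p ^ l +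
      p ^ (j+1) * ∑ l ∈ Finset.range (j+1), ((j + l).choose l : ℂ) * q ^ l = 1 := by
    induction j with
    | zero => simp; linear_combination h
    | succ j ih =>
      have e1 := step p q h j
      have e2 := step q p (by rw [add_comm, h]) j
      rw [show j + 1 + 1 = j + 2 from rfl, e1, e2, mul_comm q p]
      linear_combination ih - 2 * ((j + (j + 1)).choose (j+1) : ℂ) * (p * q) ^ (j+1) * h
  rw [← main, Finset.mul_sum, Finset.mul_sum, ← Finset.sum_add_distrib]
  exact Finset.sum_congr rfl fun l _ => by ring

theorem bilateral_moment (k : ℕ) (x : ℝ) :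
    ∫ t : ℝ, Complex.exp (-(x * Complex.I) * t) * ((Real.exp (-|t|) * |t| ^ k : ℝ) : ℂ) =
      k.factorial / (1 + x * Complex.I) ^ (k + 1) + k.factorial / (1 - x * Complex.I) ^ (k + 1) := by
  have hint : Integrable (fun t : ℝ => Complex.exp (-(x * Complex.I) * t) *
      ((Real.exp (-|t|) * |t| ^ k : ℝ) : ℂ)) := by
    refine (expAbs_integrable k).mono' (by
      apply Continuous.aestronglyMeasurable; fun_prop) (.of_forall fun t => ?_)
    rw [norm_mul, Complex.norm_exp, Complex.norm_real, Real.norm_of_nonneg (by positivity)]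
    simp
  rw [← setIntegral_univ, ← Set.Iic_union_Ioi (a := (0:ℝ)),
    setIntegral_union (Set.Iic_disjoint_Ioi le_rfl) measurableSet_Ioi hint.integrableOn
      hint.integrableOn, add_comm]
  congr 1
  · rw [← laplace_moment]
    refine setIntegral_congr_fun measurableSet_Ioi fun t ht => ?_
    simp only [abs_of_pos (Set.mem_Ioi.1 ht)]
    push_cast
    rw [← mul_assoc, ← Complex.exp_add, mul_comm]
    congr 2; ring
  · have := laplace_moment k (-x)
    rw [show (1 + ((-x : ℝ) : ℂ) * Complex.I) = 1 - x * Complex.I by push_cast; ring] at this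
    rw [← this, ← neg_zero, ← integral_comp_neg_Iic, neg_zero]
    refine setIntegral_congr_fun measurableSet_Iic fun t ht => ?_
    simp only [abs_of_nonpos (Set.mem_Iic.1 ht)]
    push_cast
    rw [← mul_assoc, ← Complex.exp_add, mul_comm]
    congr 2; ring

theorem poch_half (j : ℕ) : poch (1/2) j = (2 * j).factorial / (4 ^ j * j.factorial) := by
  induction j with
  | zero => simp [poch]
  | succ j ih =>
    have h : poch (1/2) (j+1) = poch (1/2) j * (1/2 + j) := by
      simp [poch, Finset.prod_range_succ]
    rw [h, ih, show 2 * (j+1) = 2 * j + 1 + 1 by ring, Nat.factorial_succ, Nat.factorial_succ,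
      Nat.factorial_succ]
    push_cast
    field_simp
    ring

theorem bessel_alg (j : ℕ) (x : ℝ) :
    ∑ k ∈ Finset.range (j + 1), ((((j.factorial : ℝ) * (2 * j - k).factorial * 2 ^ k) /
      ((2 * j).factorial * (j - k).factorial * k.factorial) : ℝ) : ℂ) *
      (k.factorial / (1 + x * Complex.I) ^ (k + 1) + k.factorial / (1 - x * Complex.I) ^ (k + 1))
      = 2 * π * (studentDensity j x : ℂ) := by
  have hz : (1 + x * Complex.I : ℂ) ≠ 0 := by
    intro h; have := congrArg Complex.re h; simp at this
  have hw : (1 - x * Complex.I : ℂ) ≠ 0 := by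
    intro h; have := congrArg Complex.re h; simp at this
  have hzw : ((1 + x ^ 2 : ℝ) : ℂ) = (1 + x * Complex.I) * (1 - x * Complex.I) := by
    push_cast; linear_combination ((x:ℂ)^2) * Complex.I_sq
  have cb := chaundy_bullard ((1 + x * Complex.I) / 2) ((1 - x * Complex.I) / 2) (by ring) j
  have hs : (studentDensity j x : ℂ) = ((j.factorial : ℂ) ^ 2 * 4 ^ j / (π * (2 * j).factorial)) /
      ((1 + x * Complex.I) * (1 - x * Complex.I)) ^ (j+1) := by
    rw [← hzw, studentDensity, poch_half]
    push_cast
    have : (π : ℂ) ≠ 0 := by exact_mod_cast Real.pi_ne_zero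
    congr 1
    field_simp
  have hpi : (π : ℂ) ≠ 0 := by exact_mod_cast Real.pi_ne_zero
  rw [hs]
  generalize (1 + x * Complex.I : ℂ) = z at *
  generalize (1 - x * Complex.I : ℂ) = w at *
  have hf : ((2 * j).factorial : ℂ) ≠ 0 := by exact_mod_cast (2*j).factorial_ne_zero
  trans 2 * π * (((j.factorial : ℂ) ^ 2 * 4 ^ j / (π * (2 * j).factorial)) / (z * w) ^ (j+1)) * 1
  swap
  · ring
  rw [← cb, Finset.mul_sum, ← Finset.sum_range_reflect]
  refine Finset.sum_congr rfl fun l hl => ?_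
  have hl : l ≤ j := by simpa [Nat.lt_succ_iff] using hl
  obtain ⟨i, rfl⟩ := Nat.exists_eq_add_of_le hl
  have e1 : l + i + 1 - 1 - l = i := by omega
  have e2 : 2 * (l + i) - i = l + i + l := by omega
  have e3 : l + i - i = l := by omega
  rw [e1, e2, e3, Nat.cast_choose ℂ (show l ≤ l + i + l by omega), show l + i + l - l = l + i by omega]
  have hl' : (l.factorial : ℂ) ≠ 0 := by exact_mod_cast l.factorial_ne_zero
  have hi' : (i.factorial : ℂ) ≠ 0 := by exact_mod_cast i.factorial_ne_zero
  have hli' : ((l+i).factorial : ℂ) ≠ 0 := by exact_mod_cast (l+i).factorial_ne_zero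
  have e4 : (4 : ℂ) ^ (l+i) = 2 ^ l * 2 ^ l * 2 ^ i * 2 ^ i := by
    rw [show (4:ℂ) = 2 * 2 by norm_num, mul_pow, pow_add]; ring
  rw [e4]
  push_cast
  simp only [div_pow, mul_pow, pow_add, pow_one]
  field_simp

/-- The characteristic function of the Student density, rescaled. -/
noncomputable def charG (j : ℕ) (s t : ℝ) : ℂ :=
  ((Real.exp (-|2 * π * s * t|) * besselQ j (|2 * π * s * t|) : ℝ) : ℂ)

theorem besselQ_continuous (j : ℕ) : Continuous (besselQ j) := by
  unfold besselQ; fun_prop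

theorem charG_continuous (j : ℕ) (s : ℝ) : Continuous (charG j s) := by
  have := besselQ_continuous j
  unfold charG; fun_prop

theorem expBessel_integrable (j : ℕ) :
    Integrable (fun t : ℝ => Real.exp (-|t|) * besselQ j |t|) := by
  simp only [besselQ, Finset.mul_sum]
  refine integrable_finsetSum _ fun k _ => ?_
  simp only [mul_left_comm (Real.exp _)]
  exact (expAbs_integrable k).const_mul _

theorem charG_integrable (j : ℕ) {s : ℝ} (hs : 0 < s) : Integrable (charG j s) := by
  have : 2 * π * s ≠ 0 := by positivity
  exact ((expBessel_integrable j).comp_mul_left' this).ofReal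

theorem charfun_integral (j : ℕ) (x : ℝ) :
    ∫ t : ℝ, Complex.exp (-(x * Complex.I) * t) *
      ((Real.exp (-|t|) * besselQ j |t| : ℝ) : ℂ) = 2 * π * (studentDensity j x : ℂ) := by
  rw [← bessel_alg]
  simp only [← bilateral_moment, ← integral_const_mul]
  rw [← integral_finsetSum]
  · congr 1; ext t
    rw [besselQ]; push_cast
    rw [Finset.mul_sum, Finset.mul_sum]
    exact Finset.sum_congr rfl fun k _ => by ring
  · intro k _
    refine Integrable.const_mul ?_ _
    refine (expAbs_integrable k).mono' (by
      apply Continuous.aestronglyMeasurable; fun_prop) (.of_forall fun t => ?_)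
    rw [norm_mul, Complex.norm_exp, Complex.norm_real, Real.norm_of_nonneg (by positivity)]
    simp

open FourierTransform

theorem fourier_charG (j : ℕ) {s : ℝ} (hs : 0 < s) (w : ℝ) :
    𝓕 (charG j s) w = ((1 / s * studentDensity j (w / s) : ℝ) : ℂ) := by
  have h0 : 0 < 2 * π * s := by positivity
  rw [Real.fourier_real_eq_integral_exp_smul]
  have h1 := Measure.integral_comp_mul_left (fun t : ℝ => Complex.exp (-((w / s : ℝ) * Complex.I) * t) *
      ((Real.exp (-|t|) * besselQ j |t| : ℝ) : ℂ)) (2 * π * s)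
  rw [charfun_integral, abs_of_pos (inv_pos.2 h0)] at h1
  have hpi : (π : ℂ) ≠ 0 := by exact_mod_cast Real.pi_ne_zero
  have hs' : (s : ℂ) ≠ 0 := by exact_mod_cast hs.ne'
  trans ∫ x : ℝ, Complex.exp (-((w / s : ℝ) * Complex.I) * (2 * π * s * x : ℝ)) *
      ((Real.exp (-|2 * π * s * x|) * besselQ j |2 * π * s * x| : ℝ) : ℂ)
  · congr 1; ext t
    rw [charG, smul_eq_mul]
    congr 2
    push_cast; field_simp
  · rw [h1, Complex.real_smul]
    push_cast; field_simp

theorem studentDensity_neg (j : ℕ) (x : ℝ) : studentDensity j (-x) = studentDensity j x := by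
  simp [studentDensity]

theorem studentDensity_integrable (j : ℕ) : Integrable (studentDensity j) := by
  unfold studentDensity
  simp only [div_eq_mul_inv _ (_ ^ (j+1))]
  refine Integrable.const_mul ?_ _
  refine integrable_inv_one_add_sq.mono' (by
    apply Continuous.aestronglyMeasurable
    exact Continuous.inv₀ (by fun_prop) fun x => by positivity) (.of_forall fun x => ?_)
  rw [Real.norm_of_nonneg (by positivity)]
  have : 1 ≤ 1 + x ^ 2 := by nlinarith [sq_nonneg x]
  exact inv_anti₀ (by positivity) (le_self_pow₀ this (by omega))

theorem fourier_modulate (G : ℝ → ℂ) (x y : ℝ) :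
    𝓕 (fun t : ℝ => Complex.exp ((2 * π * x * t : ℝ) * Complex.I) * G t) y = 𝓕 G (y - x) := by
  rw [Real.fourier_real_eq_integral_exp_smul, Real.fourier_real_eq_integral_exp_smul]
  congr 1; ext t
  rw [smul_eq_mul, smul_eq_mul, ← mul_assoc, ← Complex.exp_add]
  congr 2
  push_cast; ring

theorem fourier_swap (f g : ℝ → ℂ) (hf : Integrable f) (hg : Integrable g) :
    ∫ y, 𝓕 f y * g y = ∫ t, f t * 𝓕 g t := by
  have := VectorFourier.integral_fourierIntegral_smul_eq_flip (μ := (volume : Measure ℝ)) (ν := (volume : Measure ℝ))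
    (L := innerₗ ℝ) Real.continuous_fourierChar continuous_inner hf hg
  simp only [smul_eq_mul, flip_innerₗ] at this
  exact this

theorem student_t_convolution
    (n m : ℕ) (a : ℝ) (ha : 0 < a) (ha1 : a < 1)
    (β : ℕ → ℝ)
    (hβ : ∀ u : ℝ, besselQ n (a * u) * besselQ m ((1 - a) * u) =
      ∑ k ∈ Finset.range (n + m + 1), β k * besselQ k u)
    (x : ℝ) :
    ∫ y : ℝ, (1 / (a * (1 - a))) * studentDensity n (y / a) *
        studentDensity m ((x - y) / (1 - a)) =
      ∑ k ∈ Finset.range (n + m + 1), β k * studentDensity k x := by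
  have hb : 0 < 1 - a := by linarith
  set G2 : ℝ → ℂ := fun t => Complex.exp ((2 * π * x * t : ℝ) * Complex.I) * charG m (1 - a) t with hG2
  have hG2c : Continuous G2 := by
    have := charG_continuous m (1 - a)
    fun_prop
  have hG2i : Integrable G2 := by
    refine (charG_integrable m hb).norm.mono' hG2c.aestronglyMeasurable (.of_forall fun t => ?_)
    rw [hG2]
    simp only [norm_mul, Complex.norm_exp_ofReal_mul_I, one_mul, le_refl]
  have hFG2 : 𝓕 G2 = fun y => ((1 / (1 - a) * studentDensity m ((y - x) / (1 - a)) : ℝ) : ℂ) := by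
    ext y
    rw [hG2, fourier_modulate, fourier_charG m hb]
  have hFi : Integrable (𝓕 G2) := by
    rw [hFG2]
    exact ((((studentDensity_integrable m).comp_div hb.ne').comp_sub_right x).const_mul _).ofReal
  have hFF : ∀ t, 𝓕 (𝓕 G2) t = G2 (-t) := by
    intro t
    rw [← congrFun (hG2c.fourierInv_fourier_eq hG2i hFi) (-t), Real.fourierInv_eq_fourier_neg, neg_neg]
  have hsw := fourier_swap (charG n a) (𝓕 G2) (charG_integrable n ha) hFi
  apply Complex.ofReal_injective
  rw [← integral_complex_ofReal]
  trans ∫ y, 𝓕 (charG n a) y * 𝓕 G2 y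
  · congr 1; ext y
    rw [fourier_charG n ha, hFG2, ← Complex.ofReal_mul]
    congr 1
    rw [show (x - y) / (1 - a) = -((y - x) / (1 - a)) by ring, studentDensity_neg, one_div_mul_eq_div, one_div_mul_eq_div, one_div_mul_eq_div]
    field_simp
  rw [hsw]
  simp only [hFF]
  have hR : ((∑ k ∈ Finset.range (n + m + 1), β k * studentDensity k x : ℝ) : ℂ) =
      ∑ k ∈ Finset.range (n + m + 1), (β k : ℂ) * 𝓕 (charG k 1) x := by
    push_cast
    refine Finset.sum_congr rfl fun k _ => ?_
    rw [fourier_charG k one_pos]; simp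
  rw [hR]
  simp only [Real.fourier_real_eq_integral_exp_smul, ← integral_const_mul]
  rw [← integral_finsetSum]
  · congr 1; ext t
    have e1 : |2 * π * a * t| = a * |2 * π * 1 * t| := by
      rw [← abs_of_pos ha, ← abs_mul, abs_of_pos ha]; congr 1; ring
    have e2 : |2 * π * (1 - a) * -t| = (1 - a) * |2 * π * 1 * t| := by
      rw [← abs_of_pos hb, ← abs_mul, abs_of_pos hb, ← abs_neg]; congr 1; ring
    have e3 : ∑ k ∈ Finset.range (n + m + 1), (β k : ℂ) * charG k 1 t =
        charG n a t * charG m (1 - a) (-t) := by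
      simp only [charG, e1, e2]
      rw [← Complex.ofReal_mul, mul_mul_mul_comm, hβ, ← Real.exp_add]
      push_cast
      rw [Finset.mul_sum]
      refine Finset.sum_congr rfl fun k _ => ?_
      rw [show -((a:ℂ) * ((|2 * π * 1 * t| : ℝ) : ℂ)) + -((1 - a) * ((|2 * π * 1 * t| : ℝ) : ℂ)) = -((|2 * π * 1 * t| : ℝ) : ℂ) by ring]
      ring
    rw [hG2]
    simp only [smul_eq_mul]
    simp only [mul_left_comm _ (Complex.exp _), ← Finset.mul_sum]
    rw [e3]
    congr 3
    ring
  · intro k _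
    refine Integrable.const_mul ?_ _
    have hc := charG_continuous k 1
    refine (charG_integrable k one_pos).norm.mono' (by
      apply Continuous.aestronglyMeasurable; fun_prop) (.of_forall fun t => ?_)
    simp only [smul_eq_mul, norm_mul, Complex.norm_exp_ofReal_mul_I, one_mul, le_refl]
end
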